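/- Fix real numbers α, ε with 0 < α < 1/10 and 0 < ε < 1/10 and set β := −ε. Let x := 1 − 2L, y := H − 4L − (5/6)P, e := 2 − H + L + (1/3)P (the Chern character of 𝓔), and q := 3 − H − L + (1/3)P (the Chern character of 𝒬^∨), and set p₁ := −Z_{α,β}(q) (the central charge of 𝒬^∨[1]) and p₂ := Z_{α,β}(e) (the central charge of 𝓔[2]). Then no integral linear combination of Z_{α,β}(x) and Z_{α,β}(y) lies in the open parallelogram spanned by p₁ and p₂: for all integers n, m and all real s, t with 0 < s < 1 and 0 < t < 1, one has n·Z_{α,β}(x) + m·Z_{α,β}(y) ≠ s·p₁ + t·p₂. (Explicitly, Z_{α,β}(x) = (5α² + 2 − 5ε²) + 10ε·i, Z_{α,β}(y) = (4 − 10ε) + 10i, p₁ = (−15α² − 1 − 10ε + 15ε²) + 10(1−3ε)i, and p₂ = (10α² − 1 + 10ε − 10ε²) + 10(2ε−1)i; moreover p₁ + p₂ = −Z_{α,β}(x), so (n,m) = (−1,0) gives exactly the closed corner s = t = 1.) This is the numerical verification that, for a conic C on X with I_C ∉ 𝒜_X, the projection pr(I_C)[1] is σ(α, −ε)-stable in the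 alternative Kuznetsov component 𝒜_X. -/

import Mathlib

namespace GMpaper

/-- An element `(r, c, s, t)` of `ℚ × ℚ × ℚ × ℚ` stands for `r·1 + c·H + s·L + t·P`
in the numerical intersection ring of a GM threefold. -/
abbrev R4 : Type := ℚ × ℚ × ℚ × ℚ

/-- The tilt central charge: for `u = r·1 + c·H + s·L + t·P`,
`Z_{α,β}(u) = (5α²r - s + 10βc - 5β²r) + 10(c - βr)·i`. -/
noncomputable def Z (α β : ℝ) (u : R4) : ℂ :=
  ((5 * α ^ 2 * (u.1 : ℝ) - (u.2.2.1 : ℝ) + 10 * β * (u.2.1 : ℝ)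
      - 5 * β ^ 2 * (u.1 : ℝ) : ℝ) : ℂ)
    + ((10 * ((u.2.1 : ℝ) - β * (u.1 : ℝ)) : ℝ) : ℂ) * Complex.I

/-- `x = 1 - 2L`. -/
def x : R4 := (1, 0, -2, 0)
/-- `y = H - 4L - (5/6)P`. -/
def y : R4 := (0, 1, -4, -5/6)
/-- `e = 2 - H + L + (1/3)P`, the Chern character of `𝓔`. -/
def e : R4 := (2, -1, 1, 1/3)
/-- `q = 3 - H - L + (1/3)P`, the Chern character of `𝒬^∨`. -/
def q : R4 := (3, -1, -1, 1/3)

/-- For `0 < α < 1/10`, `0 < ε < 1/10` and `β = -ε`, no integral linear combination of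
`Z_{α,β}(x)` and `Z_{α,β}(y)` lies in the open parallelogram spanned by
`p₁ = Z_{α,β}(𝒬^∨[1]) = -Z_{α,β}(𝒬^∨)` and `p₂ = Z_{α,β}(𝓔[2]) = Z_{α,β}(𝓔)`; explicitly,
`Z_{α,β}(x) = (5α² + 2 - 5ε²) + 10ε·i`, `Z_{α,β}(y) = (4 - 10ε) + 10i`,
`p₁ = (-15α² - 1 - 10ε + 15ε²) + 10(1-3ε)i`, `p₂ = (10α² - 1 + 10ε - 10ε²) + 10(2ε-1)i`,
and `p₁ + p₂ = -Z_{α,β}(x)`, so `(n,m) = (-1,0)` gives exactly the closed corner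
`s = t = 1`. This is the numerical verification that `pr(I_C)[1]` is `σ(α, -ε)`-stable
in `𝒜_X` for a conic `C` with `I_C ∉ 𝒜_X`. -/
theorem stmt9 (α ε : ℝ) (hα : 0 < α) (hα' : α < 1/10) (hε : 0 < ε) (hε' : ε < 1/10) :
    (∀ n m : ℤ, ∀ s t : ℝ, 0 < s → s < 1 → 0 < t → t < 1 →
      (n : ℂ) * Z α (-ε) x + (m : ℂ) * Z α (-ε) y ≠
        (s : ℂ) * (-Z α (-ε) q) + (t : ℂ) * Z α (-ε) e) ∧
    Z α (-ε) x =
      ((5 * α ^ 2 + 2 - 5 * ε ^ 2 : ℝ) : ℂ) + ((10 * ε : ℝ) : ℂ) * Complex.I ∧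
    Z α (-ε) y = ((4 - 10 * ε : ℝ) : ℂ) + ((10 : ℝ) : ℂ) * Complex.I ∧
    -Z α (-ε) q =
      ((-15 * α ^ 2 - 1 - 10 * ε + 15 * ε ^ 2 : ℝ) : ℂ)
        + ((10 * (1 - 3 * ε) : ℝ) : ℂ) * Complex.I ∧
    Z α (-ε) e =
      ((10 * α ^ 2 - 1 + 10 * ε - 10 * ε ^ 2 : ℝ) : ℂ)
        + ((10 * (2 * ε - 1) : ℝ) : ℂ) * Complex.I ∧
    (-Z α (-ε) q) + Z α (-ε) e = -Z α (-ε) x := by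
  have hx : Z α (-ε) x =
      ((5 * α ^ 2 + 2 - 5 * ε ^ 2 : ℝ) : ℂ) + ((10 * ε : ℝ) : ℂ) * Complex.I := by
    simp [Z, x]
  have hy : Z α (-ε) y = ((4 - 10 * ε : ℝ) : ℂ) + ((10 : ℝ) : ℂ) * Complex.I := by
    simp [Z, y]; ring
  have hq : -Z α (-ε) q =
      ((-15 * α ^ 2 - 1 - 10 * ε + 15 * ε ^ 2 : ℝ) : ℂ)
        + ((10 * (1 - 3 * ε) : ℝ) : ℂ) * Complex.I := by
    simp [Z, q]; ring
  have he : Z α (-ε) e =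
      ((10 * α ^ 2 - 1 + 10 * ε - 10 * ε ^ 2 : ℝ) : ℂ)
        + ((10 * (2 * ε - 1) : ℝ) : ℂ) * Complex.I := by
    simp [Z, e]; ring
  refine ⟨?_, hx, hy, hq, he, ?_⟩
  · intro n m s t hs hs' ht ht' h
    rw [hx, hy, hq, he] at h
    have hre : (n : ℝ) * (5 * α ^ 2 + 2 - 5 * ε ^ 2) + m * (4 - 10 * ε) =
        s * (-15 * α ^ 2 - 1 - 10 * ε + 15 * ε ^ 2)
          + t * (10 * α ^ 2 - 1 + 10 * ε - 10 * ε ^ 2) := by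
      have := congrArg Complex.re h
      simpa [-Complex.ofReal_add, -Complex.ofReal_sub, -Complex.ofReal_mul,
        -Complex.ofReal_pow] using this
    have him : (n : ℝ) * (10 * ε) + m * 10 =
        s * (10 * (1 - 3 * ε)) + t * (10 * (2 * ε - 1)) := by
      have := congrArg Complex.im h
      simpa [-Complex.ofReal_add, -Complex.ofReal_sub, -Complex.ofReal_mul,
        -Complex.ofReal_pow] using this
    have key : (m : ℝ) * (2 - 4 * ε + 5 * ε ^ 2 + 5 * α ^ 2) =
        (s - t) * (2 - 5 * ε + 5 * ε ^ 2 + 5 * α ^ 2) := by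
      linear_combination (5 * α ^ 2 + 2 - 5 * ε ^ 2) / 10 * him - ε * hre
    have hE : 0 < 2 - 5 * ε + 5 * ε ^ 2 + 5 * α ^ 2 := by nlinarith [sq_nonneg ε, sq_nonneg α]
    have h1 : (m : ℝ) < 1 := by
      by_contra! hc
      nlinarith
    have h2 : (-1 : ℝ) < m := by
      by_contra! hc
      nlinarith
    have h1' : m < 1 := by exact_mod_cast h1
    have h2' : -1 < m := by exact_mod_cast h2
    obtain rfl : m = 0 := by omega
    have hst : s = t := by
      have : (s - t) * (2 - 5 * ε + 5 * ε ^ 2 + 5 * α ^ 2) = 0 := by rw [← key]; simp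
      rcases mul_eq_zero.mp this with h0 | h0
      · linarith
      · linarith
    subst hst
    have hn : (n : ℝ) = -s := by
      have : (10 * ε) * ((n : ℝ) + s) = 0 := by
        push_cast at him
        linear_combination him
      rcases mul_eq_zero.mp this with h0 | h0
      · linarith
      · linarith
    have a1 : n < 0 := by
      have : (n : ℝ) < 0 := by linarith
      exact_mod_cast this
    have a2 : -1 < n := by
      have : (-1 : ℝ) < n := by linarith
      exact_mod_cast this
    omega
  · rw [hx, hq, he]
    push_cast
    ring


end GMpaper
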